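/- Let Q be a finite index set with |Q| = z ≥ 1 and let (U_q)_{q∈Q} be pairwise independent random variables, each uniformly distributed on [0,1]. Let ε ∈ (0, 1/4) and let k be a real number with k ≥ 9/ε² and k/((1−ε)z) ≤ 1. Then the probability that fewer than k of the variables U_q take a value smaller than k/((1−ε)z) is at most 1/9. -/

import Mathlib

open MeasureTheory ProbabilityTheory

/-- The variance of the indicator of an event is at most the probability of the event. -/
lemma variance_indicator_one_le {Ω : Type*} [MeasurableSpace Ω] {μ : Measure Ω}
    [IsProbabilityMeasure μ] {A : Set Ω} (hA : MeasurableSet A) :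
    variance (A.indicator (1 : Ω → ℝ)) μ ≤ μ.real A := by
  refine (variance_le_expectation_sq
    (measurable_one.indicator hA).aestronglyMeasurable).trans_eq ?_
  rw [← integral_indicator_one hA]
  congr 1 with ω
  by_cases h : ω ∈ A <;> simp [h]

/-- Chebyshev's lower tail bound for the number of occurring events in a finite family whose
indicators are pairwise independent. -/
lemma measure_sum_indicator_le_sub_le {Ω Q : Type*} [MeasurableSpace Ω] [Fintype Q]
    {μ : Measure Ω} [IsProbabilityMeasure μ] {A : Q → Set Ω} (hA : ∀ q, MeasurableSet (A q))
    (hind : Pairwise fun q q' =>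
      IndepFun ((A q).indicator (1 : Ω → ℝ)) ((A q').indicator (1 : Ω → ℝ)) μ)
    {c : ℝ} (hc : 0 < c) :
    μ {ω | ∑ q, (A q).indicator (1 : Ω → ℝ) ω ≤ ∑ q, μ.real (A q) - c} ≤
      ENNReal.ofReal ((∑ q, μ.real (A q)) / c ^ 2) := by
  have hL (q : Q) : MemLp ((A q).indicator (1 : Ω → ℝ)) 2 μ :=
    memLp_indicator_const 2 (hA q) (1 : ℝ) (.inr (measure_ne_top μ _))
  have hmean : ∫ ω, (∑ q, (A q).indicator (1 : Ω → ℝ)) ω ∂μ = ∑ q, μ.real (A q) := by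
    simp only [Finset.sum_apply]
    rw [integral_finsetSum _ fun q _ => (hL q).integrable one_le_two]
    exact Finset.sum_congr rfl fun q _ => integral_indicator_one (hA q)
  have hvar : variance (∑ q, (A q).indicator (1 : Ω → ℝ)) μ ≤ ∑ q, μ.real (A q) := by
    rw [IndepFun.variance_sum (fun q _ => hL q) fun q _ q' _ h => hind h]
    exact Finset.sum_le_sum fun q _ => variance_indicator_one_le (hA q)
  calc
    _ ≤ μ {ω | c ≤ |(∑ q, (A q).indicator (1 : Ω → ℝ)) ω -
          ∫ ω, (∑ q, (A q).indicator (1 : Ω → ℝ)) ω ∂μ|} := by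
      refine measure_mono fun ω hω => ?_
      rw [Set.mem_ofPred_eq] at hω ⊢
      rw [hmean, Finset.sum_apply, abs_sub_comm]
      exact le_abs.2 (.inl (by linarith))
    _ ≤ _ := meas_ge_le_variance_div_sq (memLp_finsetSum' _ fun q _ => hL q) hc
    _ ≤ _ := by gcongr

/-- A random variable uniform on `[0,1]` is smaller than `p ∈ [0,1]` with probability `p`. -/
lemma measureReal_lt_of_map_eq_restrict_Icc {Ω : Type*} [MeasurableSpace Ω] {μ : Measure Ω}
    {X : Ω → ℝ} (hX : Measurable X)
    (hunif : Measure.map X μ = volume.restrict (Set.Icc (0 : ℝ) 1))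
    {p : ℝ} (hp0 : 0 ≤ p) (hp1 : p ≤ 1) :
    μ.real {ω | X ω < p} = p := by
  have hset : Set.Iio p ∩ Set.Icc 0 1 = Set.Ico 0 p := by
    ext x
    simp only [Set.mem_inter_iff, Set.mem_Iio, Set.mem_Icc, Set.mem_Ico]
    exact ⟨fun h => ⟨h.2.1, h.1⟩, fun h => ⟨h.2, h.1, h.2.le.trans hp1⟩⟩
  have h : μ (X ⁻¹' Set.Iio p) = ENNReal.ofReal p := by
    rw [← Measure.map_apply hX measurableSet_Iio, hunif,
      Measure.restrict_apply measurableSet_Iio, hset, Real.volume_Ico, sub_zero]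
  change (μ (X ⁻¹' Set.Iio p)).toReal = p
  rw [h, ENNReal.toReal_ofReal hp0]

/-- Underestimation bound: for `z` pairwise independent uniform `[0,1]` random
variables, `ε ∈ (0,1/4)` and `k ≥ 9/ε²` with `k/((1-ε)z) ≤ 1`, the probability
that fewer than `k` of the variables are smaller than `k/((1-ε)z)` is at most `1/9`. -/
theorem prob_underestimate_le
    {Ω Q : Type*} [MeasurableSpace Ω] [Fintype Q]
    (μ : Measure Ω) [IsProbabilityMeasure μ]
    (z : ℕ) (hz : 1 ≤ z) (hQ : Fintype.card Q = z)
    (U : Q → Ω → ℝ) (hmeas : ∀ q, Measurable (U q))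
    (hunif : ∀ q, Measure.map (U q) μ = volume.restrict (Set.Icc (0 : ℝ) 1))
    (hpi : Pairwise fun q q' => IndepFun (U q) (U q') μ)
    (ε k : ℝ) (hε : ε ∈ Set.Ioo (0 : ℝ) (1 / 4)) (hk : 9 / ε ^ 2 ≤ k)
    (hk1 : k / ((1 - ε) * z) ≤ 1) :
    μ {ω | (Nat.card {q : Q // U q ω < k / ((1 - ε) * (z : ℝ))} : ℝ) < k} ≤ 1 / 9 := by
  obtain ⟨hε0, hε1⟩ := hε
  have hk0 : 0 < k := lt_of_lt_of_le (by positivity) hk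
  have hkε : 9 ≤ k * ε ^ 2 := (div_le_iff₀ (by positivity)).1 hk
  have hz0 : (0 : ℝ) < z := by exact_mod_cast hz
  have h1ε : 0 < 1 - ε := by linarith
  set p := k / ((1 - ε) * (z : ℝ)) with hp
  have hp0 : 0 < p := by positivity
  let A : Q → Set Ω := fun q => {ω | U q ω < p}
  have hA (q : Q) : MeasurableSet (A q) := measurableSet_lt (hmeas q) measurable_const
  have hsum : ∑ q, μ.real (A q) = k / (1 - ε) := by
    have hq (q : Q) : μ.real (A q) = p :=
      measureReal_lt_of_map_eq_restrict_Icc (hmeas q) (hunif q) hp0.le hk1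
    simp only [hq, Finset.sum_const, Finset.card_univ, hQ, nsmul_eq_mul, hp]
    field_simp
  have hind : Pairwise fun q q' =>
      IndepFun ((A q).indicator (1 : Ω → ℝ)) ((A q').indicator (1 : Ω → ℝ)) μ := by
    have hg : Measurable ((Set.Iio p).indicator (1 : ℝ → ℝ)) :=
      measurable_one.indicator measurableSet_Iio
    exact fun q q' h => (hpi h).comp hg hg
  have hcount (ω : Ω) : (Nat.card {q : Q // U q ω < p} : ℝ) =
      ∑ q, (A q).indicator (1 : Ω → ℝ) ω := by
    classical
    simp [A, Set.indicator_apply, Nat.card_eq_fintype_card, Fintype.card_subtype]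
  have hc : 0 < ε * k / (1 - ε) := by positivity
  have hgap : k / (1 - ε) - ε * k / (1 - ε) = k := by
    field_simp
  calc
    _ ≤ μ {ω | ∑ q, (A q).indicator (1 : Ω → ℝ) ω ≤
          ∑ q, μ.real (A q) - ε * k / (1 - ε)} := by
      refine measure_mono fun ω hω => ?_
      rw [Set.mem_ofPred_eq, hcount] at hω
      rw [Set.mem_ofPred_eq, hsum, hgap]
      exact hω.le
    _ ≤ _ := measure_sum_indicator_le_sub_le hA hind hc
    _ ≤ ENNReal.ofReal (1 / 9) := by
      refine ENNReal.ofReal_le_ofReal ?_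
      have hratio : k / (1 - ε) / (ε * k / (1 - ε)) ^ 2 = (1 - ε) / (k * ε ^ 2) := by
        field_simp
      rw [hsum, hratio, div_le_div_iff₀ (by positivity) (by norm_num)]
      linarith
    _ = 1 / 9 := by
      rw [ENNReal.ofReal_div_of_pos (by norm_num)]
      simp
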